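/- The real Koba-Nielsen local zeta function for N = 5, namely Z^(5)(s) = ∫_{ℝ²} |x₂|^{s₁₂} |x₃|^{s₁₃} |1−x₂|^{s₄₂} |1−x₃|^{s₄₃} |x₂−x₃|^{s₂₃} dx₂ dx₃, converges and is holomorphic in (s₁₂, s₁₃, s₄₂, s₄₃, s₂₃) ∈ ℂ⁵ on the region defined by: Re(s_{ij}) > −1 for all five indices ij; Re(s₁₂) + Re(s₁₃) + Re(s₂₃) > −2; Re(s₄₂) + Re(s₄₃) + Re(s₂₃) > −2; Re(s₁₂) + Re(s₄₂) + Re(s₂₃) < −1; Re(s₁₃) + Re(s₄₃) + Re(s₂₃) < −1; and Re(s₁₂) + Re(s₁₃) + Re(s₄₂) + Re(s₄₃) + Re(s₂₃) < −2. -/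

import Mathlib

open MeasureTheory

/-- The integrand of the real Koba-Nielsen local zeta function `Z^(5)(s)`, in the variables
`x = (x₂, x₃) ∈ ℝ²`, with `s = (s₁₂, s₁₃, s₄₂, s₄₃, s₂₃)`. -/
noncomputable def KN5integrand (s : ℂ × ℂ × ℂ × ℂ × ℂ) (x : ℝ × ℝ) : ℂ :=
  ((|x.1| : ℝ) : ℂ) ^ s.1 * ((|x.2| : ℝ) : ℂ) ^ s.2.1 *
    ((|1 - x.1| : ℝ) : ℂ) ^ s.2.2.1 * ((|1 - x.2| : ℝ) : ℂ) ^ s.2.2.2.1 *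
    ((|x.1 - x.2| : ℝ) : ℂ) ^ s.2.2.2.2

/-- The convergence region for `Z^(5)`: writing `s = (s₁₂, s₁₃, s₄₂, s₄₃, s₂₃)`, it is given
by `Re(s_{ij}) > -1` for all five indices, `Re s₁₂ + Re s₁₃ + Re s₂₃ > -2`,
`Re s₄₂ + Re s₄₃ + Re s₂₃ > -2`, `Re s₁₂ + Re s₄₂ + Re s₂₃ < -1`,
`Re s₁₃ + Re s₄₃ + Re s₂₃ < -1`, and the sum of all five real parts `< -2`. -/
def KN5region : Set (ℂ × ℂ × ℂ × ℂ × ℂ) :=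
  {s | -1 < s.1.re ∧ -1 < s.2.1.re ∧ -1 < s.2.2.1.re ∧ -1 < s.2.2.2.1.re ∧
       -1 < s.2.2.2.2.re ∧
       -2 < s.1.re + s.2.1.re + s.2.2.2.2.re ∧
       -2 < s.2.2.1.re + s.2.2.2.1.re + s.2.2.2.2.re ∧
       s.1.re + s.2.2.1.re + s.2.2.2.2.re < -1 ∧
       s.2.1.re + s.2.2.2.1.re + s.2.2.2.2.re < -1 ∧
       s.1.re + s.2.1.re + s.2.2.1.re + s.2.2.2.1.re + s.2.2.2.2.re < -2}

/-- The truncated power `|x| ^ q` on `[-1, 1]`, extended by zero. -/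
noncomputable def truncPow (q x : ℝ) : ℝ := if |x| ≤ 1 then |x| ^ q else 0

lemma truncPow_nonneg (q x : ℝ) : 0 ≤ truncPow q x := by
  unfold truncPow; split_ifs <;> positivity

lemma measurable_truncPow (q : ℝ) : Measurable (truncPow q) := by
  unfold truncPow
  exact Measurable.ite (measurableSet_le (by fun_prop) (by fun_prop)) (by fun_prop) (by fun_prop)

lemma integrable_truncPow {q : ℝ} (hq : -1 < q) : Integrable (truncPow q) := by
  have h1 : IntervalIntegrable (fun x : ℝ => |x| ^ q) volume 0 1 := by
    refine (intervalIntegral.intervalIntegrable_rpow' hq).congr fun x hx => ?_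
    rw [Set.uIoc_of_le zero_le_one] at hx
    simp only [abs_of_pos hx.1]
  have h2 : IntervalIntegrable (fun x : ℝ => |x| ^ q) volume (-1) 0 := by
    have h := (IntervalIntegrable.iff_comp_neg).1 h1
    simpa using h.symm
  have h3 := h2.trans h1
  rw [intervalIntegrable_iff_integrableOn_Icc_of_le (by norm_num)] at h3
  have h4 : truncPow q = Set.indicator (Set.Icc (-1) 1) (fun x : ℝ => |x| ^ q) := by
    ext x
    simp only [truncPow, Set.indicator, Set.mem_Icc, abs_le]
  rw [h4]
  exact h3.integrable_indicator measurableSet_Icc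

lemma integrable_one_add_abs_rpow {q : ℝ} (hq : q < -1) :
    Integrable (fun x : ℝ => (1 + |x|) ^ q) := by
  have h := integrable_one_add_norm (E := ℝ) (μ := volume) (r := -q) (by simp; linarith)
  simpa using h

lemma rpow_le_of_comparable {k u v : ℝ} (hu : 0 < u) (hv : 0 < v)
    (h1 : u ≤ k * v) (h2 : v ≤ k * u) (a : ℝ) : u ^ a ≤ k ^ |a| * v ^ a := by
  have hk : 0 < k := by
    by_contra! h
    nlinarith
  rcases le_total 0 a with ha | ha
  · rw [abs_of_nonneg ha, ← Real.mul_rpow hk.le hv.le]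
    exact Real.rpow_le_rpow hu.le h1 ha
  · have h3 : (k * u) ^ a ≤ v ^ a := Real.rpow_le_rpow_of_nonpos hv h2 ha
    rw [Real.mul_rpow hk.le hu.le] at h3
    rw [abs_of_nonpos ha, Real.rpow_neg hk.le]
    have := Real.rpow_pos_of_pos hk a
    rw [inv_mul_eq_div, le_div_iff₀ this]
    linarith

/-- In a degenerate triangle the shortest side can absorb part of the exponents of the other
two, which are comparable to each other. -/
lemma rpow_mul_le_of_shortest {u v m : ℝ} (hm : 0 < m) (hu : m ≤ u) (huv : u ≤ 2 * v)
    (hvu : v ≤ 2 * u) (a b e : ℝ) {κ : ℝ} (hκ : 0 ≤ κ) :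
    u ^ a * v ^ b * m ^ e ≤ 2 ^ |b| * (u ^ (a + b + κ) * m ^ (e - κ)) := by
  have hu0 : 0 < u := hm.trans_le hu
  have hv0 : 0 < v := by linarith
  have h1 : v ^ b ≤ 2 ^ |b| * u ^ b := rpow_le_of_comparable hv0 hu0 hvu huv b
  have h2 : m ^ κ ≤ u ^ κ := Real.rpow_le_rpow hm.le hu hκ
  calc u ^ a * v ^ b * m ^ e ≤ u ^ a * (2 ^ |b| * u ^ b) * (m ^ κ * m ^ (e - κ)) := by
        rw [← Real.rpow_add hm, add_sub_cancel]; gcongr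
    _ ≤ u ^ a * (2 ^ |b| * u ^ b) * (u ^ κ * m ^ (e - κ)) := by gcongr
    _ = _ := by rw [Real.rpow_add hu0, Real.rpow_add hu0]; ring

lemma rpow_triangle_le {u v w : ℝ} (hu : 0 < u) (hv : 0 < v) (hw : 0 < w) (h1 : u ≤ v + w)
    (h2 : v ≤ u + w) (h3 : w ≤ u + v) (a b e : ℝ) {κ₁ κ₂ κ₃ : ℝ} (hκ₁ : 0 ≤ κ₁) (hκ₂ : 0 ≤ κ₂)
    (hκ₃ : 0 ≤ κ₃) :
    u ^ a * v ^ b * w ^ e ≤ 2 ^ (|b| + |e|) *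
      (u ^ (a - κ₁) * v ^ (b + e + κ₁) + u ^ (a + e + κ₂) * v ^ (b - κ₂) +
        u ^ (a + b + κ₃) * w ^ (e - κ₃)) := by
  have hb : (2 : ℝ) ^ |b| ≤ 2 ^ (|b| + |e|) :=
    Real.rpow_le_rpow_of_exponent_le one_le_two (by linarith [abs_nonneg e])
  have he : (2 : ℝ) ^ |e| ≤ 2 ^ (|b| + |e|) :=
    Real.rpow_le_rpow_of_exponent_le one_le_two (by linarith [abs_nonneg b])
  have p1 : 0 ≤ u ^ (a - κ₁) * v ^ (b + e + κ₁) := by positivity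
  have p2 : 0 ≤ u ^ (a + e + κ₂) * v ^ (b - κ₂) := by positivity
  have p3 : 0 ≤ u ^ (a + b + κ₃) * w ^ (e - κ₃) := by positivity
  by_cases c1 : u ≤ v ∧ u ≤ w
  · have := rpow_mul_le_of_shortest hu c1.1 (v := w) (by linarith) (by linarith) b e a hκ₁
    calc u ^ a * v ^ b * w ^ e = v ^ b * w ^ e * u ^ a := by ring
      _ ≤ _ := this
      _ ≤ 2 ^ (|b| + |e|) * (v ^ (b + e + κ₁) * u ^ (a - κ₁)) := by gcongr
      _ ≤ _ := by gcongr; linarith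
  by_cases c2 : v ≤ u ∧ v ≤ w
  · have := rpow_mul_le_of_shortest hv c2.1 (v := w) (by linarith) (by linarith) a e b hκ₂
    calc u ^ a * v ^ b * w ^ e = u ^ a * w ^ e * v ^ b := by ring
      _ ≤ _ := this
      _ ≤ 2 ^ (|b| + |e|) * (u ^ (a + e + κ₂) * v ^ (b - κ₂)) := by gcongr
      _ ≤ _ := by gcongr; linarith
  have c3 : w ≤ u ∧ w ≤ v := by grind
  have := rpow_mul_le_of_shortest hw c3.1 (v := v) (by linarith) (by linarith) a b e hκ₃
  calc u ^ a * v ^ b * w ^ e ≤ _ := this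
    _ ≤ 2 ^ (|b| + |e|) * (u ^ (a + b + κ₃) * w ^ (e - κ₃)) := by gcongr
    _ ≤ _ := by gcongr; linarith

lemma measurePreserving_fst_sub : MeasurePreserving (fun z : ℝ × ℝ => (z.1, z.1 - z.2)) := by
  refine (MeasurePreserving.id (volume : Measure ℝ)).skew_product
    (g := fun x y : ℝ => x - y) (by fun_prop) (Filter.Eventually.of_forall fun x => ?_)
  exact (Measure.measurePreserving_sub_left volume x).map_eq

lemma integrable_mul_fst_sub {f g : ℝ → ℝ} (hf : Integrable f) (hg : Integrable g) :
    Integrable (fun z : ℝ × ℝ => f z.1 * g (z.1 - z.2)) := by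
  have h := (hf.mul_prod hg)
  exact measurePreserving_fst_sub.integrable_comp_of_integrable h

lemma ae_ne_zero_and_ne_one : ∀ᵐ x : ℝ, x ≠ 0 ∧ x ≠ 1 :=
  (Measure.ae_ne volume 0).and (Measure.ae_ne volume 1)

lemma ae_generic : ∀ᵐ z : ℝ × ℝ, 0 < |z.1| ∧ 0 < |z.2| ∧ 0 < |1 - z.1| ∧ 0 < |1 - z.2| ∧
    0 < |z.1 - z.2| := by
  have h1 : ∀ᵐ z : ℝ × ℝ, z.1 ≠ 0 ∧ z.1 ≠ 1 :=
    Measure.quasiMeasurePreserving_fst.ae ae_ne_zero_and_ne_one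
  have h2 : ∀ᵐ z : ℝ × ℝ, z.2 ≠ 0 ∧ z.2 ≠ 1 :=
    Measure.quasiMeasurePreserving_snd.ae ae_ne_zero_and_ne_one
  have h3 : ∀ᵐ z : ℝ × ℝ, z.1 - z.2 ≠ 0 := by
    exact (Measure.quasiMeasurePreserving_snd.comp measurePreserving_fst_sub.quasiMeasurePreserving).ae
      (Measure.ae_ne volume 0)
  filter_upwards [h1, h2, h3] with z a1 a2 a3
  simp only [abs_pos, sub_ne_zero]
  exact ⟨a1.1, a2.1, a1.2.symm, a2.2.symm, sub_ne_zero.1 a3⟩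

/-- Integrability near a triple collision point: `|x| ^ a |y| ^ b |x - y| ^ e` for `|x|, |y|`
bounded. -/
lemma integrable_local {a b e : ℝ} (ha : -1 < a) (hb : -1 < b) (he : -1 < e)
    (h : -2 < a + b + e) :
    Integrable (fun z : ℝ × ℝ =>
      if |z.1| ≤ 1 / 2 ∧ |z.2| ≤ 1 / 2 then |z.1| ^ a * |z.2| ^ b * |z.1 - z.2| ^ e else 0) := by
  obtain ⟨κ₁, k1, k1', k1''⟩ : ∃ κ : ℝ, 0 ≤ κ ∧ -1 < a - κ ∧ -1 < b + e + κ := by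
    rcases le_total 0 ((a - b - e) / 2) with h0 | h0
    · exact ⟨_, h0, by linarith, by linarith⟩
    · exact ⟨0, le_rfl, by linarith, by linarith⟩
  obtain ⟨κ₂, k2, k2', k2''⟩ : ∃ κ : ℝ, 0 ≤ κ ∧ -1 < b - κ ∧ -1 < a + e + κ := by
    rcases le_total 0 ((b - a - e) / 2) with h0 | h0
    · exact ⟨_, h0, by linarith, by linarith⟩
    · exact ⟨0, le_rfl, by linarith, by linarith⟩
  obtain ⟨κ₃, k3, k3', k3''⟩ : ∃ κ : ℝ, 0 ≤ κ ∧ -1 < e - κ ∧ -1 < a + b + κ := by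
    rcases le_total 0 ((e - a - b) / 2) with h0 | h0
    · exact ⟨_, h0, by linarith, by linarith⟩
    · exact ⟨0, le_rfl, by linarith, by linarith⟩
  have i1 := (integrable_truncPow k1').mul_prod (integrable_truncPow k1'')
  have i2 := (integrable_truncPow k2'').mul_prod (integrable_truncPow k2')
  have i3 := integrable_mul_fst_sub (integrable_truncPow k3'') (integrable_truncPow k3')
  refine (((i1.add i2).add i3).const_mul (2 ^ (|b| + |e|))).mono' ?_ ?_
  · refine (Measurable.ite ?_ (by fun_prop) (by fun_prop)).aestronglyMeasurable
    have m1 : MeasurableSet {z : ℝ × ℝ | |z.1| ≤ 1 / 2} :=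
      measurableSet_le (by fun_prop) (by fun_prop)
    have m2 : MeasurableSet {z : ℝ × ℝ | |z.2| ≤ 1 / 2} :=
      measurableSet_le (by fun_prop) (by fun_prop)
    exact m1.inter m2
  · filter_upwards [ae_generic] with z ⟨hx, hy, _, _, hxy⟩
    have p1 := truncPow_nonneg
    split_ifs with hz
    · rw [Real.norm_of_nonneg (by positivity)]
      have hw : |z.1 - z.2| ≤ 1 := (abs_sub _ _).trans (by linarith)
      have t1 : |z.1| ≤ |z.2| + |z.1 - z.2| := by
        have := abs_add_le z.2 (z.1 - z.2); rwa [add_sub_cancel] at this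
      have t2 : |z.2| ≤ |z.1| + |z.1 - z.2| := by
        have := abs_sub z.1 (z.1 - z.2); rwa [sub_sub_cancel] at this
      have := rpow_triangle_le hx hy hxy t1 t2 (abs_sub _ _) a b e k1 k2 k3
      have hx1 : |z.1| ≤ 1 := by linarith
      have hy1 : |z.2| ≤ 1 := by linarith
      simpa [truncPow, hx1, hy1, hw] using this
    · simp only [norm_zero, Pi.add_apply]
      have := p1 (a - κ₁) z.1
      have := p1 (b + e + κ₁) z.2
      have := p1 (a + e + κ₂) z.1
      have := p1 (b - κ₂) z.2
      have := p1 (a + b + κ₃) z.1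
      have := p1 (e - κ₃) (z.1 - z.2)
      positivity

/-- Integrability at infinity, where both variables may be large. -/
lemma integrable_global {a b e : ℝ} (he : -1 < e) (ha : a + e < -1) (hb : b + e < -1)
    (h : a + b + e < -2) :
    Integrable (fun z : ℝ × ℝ => (1 + |z.1|) ^ a * (1 + |z.2|) ^ b * |z.1 - z.2| ^ e) := by
  have hab : a + b < -1 := by linarith
  obtain ⟨κ₁, k1, k1', k1''⟩ : ∃ κ : ℝ, 0 ≤ κ ∧ a - κ < -1 ∧ b + e + κ < -1 := by
    rcases le_total 0 ((a - b - e) / 2) with h0 | h0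
    · exact ⟨_, h0, by linarith, by linarith⟩
    · exact ⟨0, le_rfl, by linarith, by linarith⟩
  obtain ⟨κ₂, k2, k2', k2''⟩ : ∃ κ : ℝ, 0 ≤ κ ∧ b - κ < -1 ∧ a + e + κ < -1 := by
    rcases le_total 0 ((b - a - e) / 2) with h0 | h0
    · exact ⟨_, h0, by linarith, by linarith⟩
    · exact ⟨0, le_rfl, by linarith, by linarith⟩
  obtain ⟨κ₃, k3, k3', k3''⟩ : ∃ κ : ℝ, 0 ≤ κ ∧ e - κ < -1 ∧ a + b + κ < -1 := by
    rcases le_total 0 ((e - a - b) / 2) with h0 | h0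
    · exact ⟨_, h0, by linarith, by linarith⟩
    · exact ⟨0, le_rfl, by linarith, by linarith⟩
  have i1 := (integrable_one_add_abs_rpow k1').mul_prod (integrable_one_add_abs_rpow k1'')
  have i2 := (integrable_one_add_abs_rpow k2'').mul_prod (integrable_one_add_abs_rpow k2')
  have i3 := integrable_mul_fst_sub (integrable_one_add_abs_rpow k3'')
    (integrable_one_add_abs_rpow k3')
  have i4 := integrable_mul_fst_sub (integrable_one_add_abs_rpow hab) (integrable_truncPow he)
  refine (((((i1.add i2).add i3).const_mul (2 ^ (|b| + |e|))).const_mul (2 ^ |e|)).add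
    (i4.const_mul (2 ^ |b|))).mono' (by fun_prop) ?_
  filter_upwards [ae_generic] with z ⟨hx, hy, _, _, hxy⟩
  rw [Real.norm_of_nonneg (by positivity)]
  have t1 : |z.1| ≤ |z.2| + |z.1 - z.2| := by
    have := abs_add_le z.2 (z.1 - z.2); rwa [add_sub_cancel] at this
  have t2 : |z.2| ≤ |z.1| + |z.1 - z.2| := by
    have := abs_sub z.1 (z.1 - z.2); rwa [sub_sub_cancel] at this
  have t3 := abs_sub z.1 z.2
  simp only [Pi.add_apply]
  have pn := truncPow_nonneg e (z.1 - z.2)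
  rcases le_total |z.1 - z.2| 1 with hw | hw
  · have h1 : (1 + |z.2|) ^ b ≤ 2 ^ |b| * (1 + |z.1|) ^ b :=
      rpow_le_of_comparable (by positivity) (by positivity) (by linarith) (by linarith) b
    refine le_add_of_nonneg_of_le (by positivity) ?_
    rw [truncPow, if_pos hw, Real.rpow_add (by positivity)]
    calc _ ≤ (1 + |z.1|) ^ a * (2 ^ |b| * (1 + |z.1|) ^ b) * |z.1 - z.2| ^ e := by gcongr
      _ = _ := by ring
  · have h1 : |z.1 - z.2| ^ e ≤ 2 ^ |e| * (1 + |z.1 - z.2|) ^ e :=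
      rpow_le_of_comparable (by positivity) (by positivity) (by linarith) (by linarith) e
    refine le_add_of_le_of_nonneg ?_ (by positivity)
    have := rpow_triangle_le (u := 1 + |z.1|) (v := 1 + |z.2|) (w := 1 + |z.1 - z.2|)
      (by positivity) (by positivity) (by positivity) (by linarith) (by linarith) (by linarith)
      a b e k1 k2 k3
    calc _ ≤ (1 + |z.1|) ^ a * (1 + |z.2|) ^ b * (2 ^ |e| * (1 + |z.1 - z.2|) ^ e) := by gcongr
      _ = 2 ^ |e| * ((1 + |z.1|) ^ a * (1 + |z.2|) ^ b * (1 + |z.1 - z.2|) ^ e) := by ring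
      _ ≤ _ := by gcongr

/-- The three-point integrand with singularities at `0`, `1` and `∞`. -/
lemma integrable_beta {a c e : ℝ} (ha : -1 < a) (hc : -1 < c) (h : a + c + e < -1) :
    Integrable (fun x : ℝ => |x| ^ a * |1 - x| ^ c * (1 + |x|) ^ e) := by
  have i1 := (integrable_truncPow ha).const_mul (5 ^ |c| * 5 ^ |e|)
  have i2 := ((integrable_truncPow hc).comp_sub_left 1).const_mul (5 ^ |a| * 5 ^ |e|)
  have i3 := (integrable_one_add_abs_rpow h).const_mul (5 ^ |a| * 5 ^ |c|)
  refine ((i1.add i2).add i3).mono' (by fun_prop) ?_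
  filter_upwards [ae_ne_zero_and_ne_one] with x ⟨h0, h1⟩
  have hx : 0 < |x| := abs_pos.2 h0
  have hx1 : 0 < |1 - x| := abs_pos.2 (sub_ne_zero.2 h1.symm)
  rw [Real.norm_of_nonneg (by positivity)]
  have t1 : 1 ≤ |x| + |1 - x| := by
    have := abs_add_le x (1 - x); rwa [add_sub_cancel, abs_one] at this
  have t2 : |1 - x| ≤ 1 + |x| := by simpa using abs_sub 1 x
  have t3 : |x| ≤ 1 + |1 - x| := by
    have := abs_sub 1 (1 - x); rwa [sub_sub_cancel, abs_one] at this
  have p1 := truncPow_nonneg a x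
  have p2 := truncPow_nonneg c (1 - x)
  simp only [Pi.add_apply]
  by_cases c1 : |x| ≤ 1 / 2
  · have e1 : |1 - x| ^ c ≤ 5 ^ |c| * 1 ^ c :=
      rpow_le_of_comparable hx1 one_pos (by linarith) (by linarith) c
    have e2 : (1 + |x|) ^ e ≤ 5 ^ |e| * 1 ^ e :=
      rpow_le_of_comparable (by positivity) one_pos (by linarith) (by linarith) e
    rw [Real.one_rpow, mul_one] at e1 e2
    rw [add_assoc]
    refine le_add_of_le_of_nonneg ?_ (by positivity)
    rw [truncPow, if_pos (by linarith)]
    calc _ ≤ |x| ^ a * 5 ^ |c| * 5 ^ |e| := by gcongr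
      _ = _ := by ring
  by_cases c2 : |1 - x| ≤ 1 / 2
  · have e1 : |x| ^ a ≤ 5 ^ |a| * 1 ^ a :=
      rpow_le_of_comparable hx one_pos (by linarith) (by linarith) a
    have e2 : (1 + |x|) ^ e ≤ 5 ^ |e| * 1 ^ e :=
      rpow_le_of_comparable (by positivity) one_pos (by linarith) (by linarith) e
    rw [Real.one_rpow, mul_one] at e1 e2
    refine le_add_of_le_of_nonneg (le_add_of_nonneg_of_le (by positivity) ?_) (by positivity)
    rw [truncPow, if_pos (by linarith)]
    calc _ ≤ 5 ^ |a| * |1 - x| ^ c * 5 ^ |e| := by gcongr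
      _ = _ := by ring
  · have e1 : |x| ^ a ≤ 5 ^ |a| * (1 + |x|) ^ a :=
      rpow_le_of_comparable hx (by positivity) (by linarith) (by linarith) a
    have e2 : |1 - x| ^ c ≤ 5 ^ |c| * (1 + |x|) ^ c :=
      rpow_le_of_comparable hx1 (by positivity) (by linarith) (by linarith) c
    refine le_add_of_nonneg_of_le (by positivity) ?_
    rw [Real.rpow_add (by positivity), Real.rpow_add (by positivity)]
    calc _ ≤ (5 ^ |a| * (1 + |x|) ^ a) * (5 ^ |c| * (1 + |x|) ^ c) * (1 + |x|) ^ e := by gcongr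
      _ = _ := by ring

/-- Absolute convergence for real exponents. -/
lemma integrable_kobaNielsen_real {a b c d e : ℝ} (ha : -1 < a) (hb : -1 < b) (hc : -1 < c)
    (hd : -1 < d) (he : -1 < e) (h0 : -2 < a + b + e) (h1 : -2 < c + d + e)
    (hx : a + c + e < -1) (hy : b + d + e < -1) (h : a + b + c + d + e < -2) :
    Integrable (fun z : ℝ × ℝ =>
      |z.1| ^ a * |z.2| ^ b * |1 - z.1| ^ c * |1 - z.2| ^ d * |z.1 - z.2| ^ e) := by
  have i1 := (integrable_local ha hb he h0).const_mul (32 ^ |c| * 32 ^ |d|)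
  have i2 := ((integrable_local hc hd he h1).comp_sub_left ((1 : ℝ), (1 : ℝ))).const_mul
    (32 ^ |a| * 32 ^ |b|)
  have i3 := (integrable_global (a := a + c) (b := b + d) he hx hy (by linarith)).const_mul
    (32 ^ |a| * 32 ^ |b| * 32 ^ |c| * 32 ^ |d|)
  have i4 := ((integrable_beta ha hc hx).mul_prod (integrable_beta hb hd hy)).const_mul
    (32 ^ |e|)
  refine (((i1.add i2).add i3).add i4).mono' (by fun_prop) ?_
  filter_upwards [ae_generic] with z ⟨px, py, px1, py1, pw⟩
  rw [Real.norm_of_nonneg (by positivity)]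
  simp only [Pi.add_apply, Prod.fst_sub, Prod.snd_sub, sub_sub_sub_cancel_left]
  rw [abs_sub_comm z.2 z.1]
  have x1 : 1 ≤ |z.1| + |1 - z.1| := by
    have := abs_add_le z.1 (1 - z.1); rwa [add_sub_cancel, abs_one] at this
  have x2 : |1 - z.1| ≤ 1 + |z.1| := by simpa using abs_sub 1 z.1
  have x3 : |z.1| ≤ 1 + |1 - z.1| := by
    have := abs_sub 1 (1 - z.1); rwa [sub_sub_cancel, abs_one] at this
  have y1 : 1 ≤ |z.2| + |1 - z.2| := by
    have := abs_add_le z.2 (1 - z.2); rwa [add_sub_cancel, abs_one] at this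
  have y2 : |1 - z.2| ≤ 1 + |z.2| := by simpa using abs_sub 1 z.2
  have y3 : |z.2| ≤ 1 + |1 - z.2| := by
    have := abs_sub 1 (1 - z.2); rwa [sub_sub_cancel, abs_one] at this
  have t1 : |z.1| ≤ |z.2| + |z.1 - z.2| := by
    have := abs_add_le z.2 (z.1 - z.2); rwa [add_sub_cancel] at this
  have t2 : |z.2| ≤ |z.1| + |z.1 - z.2| := by
    have := abs_sub z.1 (z.1 - z.2); rwa [sub_sub_cancel] at this
  have t3 := abs_sub z.1 z.2
  have t4 : |1 - z.1| ≤ |1 - z.2| + |z.1 - z.2| := by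
    have := abs_sub (1 - z.2) (z.1 - z.2); rwa [sub_sub_sub_cancel_right] at this
  have t5 : |1 - z.2| ≤ |1 - z.1| + |z.1 - z.2| := by
    have := abs_add_le (1 - z.1) (z.1 - z.2); rwa [sub_add_sub_cancel] at this
  generalize |z.1| = x at *
  generalize |z.2| = y at *
  generalize |1 - z.1| = x' at *
  generalize |1 - z.2| = y' at *
  generalize |z.1 - z.2| = w at *
  have n1 : 0 ≤ 32 ^ |c| * 32 ^ |d| *
      (if x ≤ 1 / 2 ∧ y ≤ 1 / 2 then x ^ a * y ^ b * w ^ e else 0) := by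
    split_ifs <;> positivity
  have n2 : 0 ≤ 32 ^ |a| * 32 ^ |b| *
      (if x' ≤ 1 / 2 ∧ y' ≤ 1 / 2 then x' ^ c * y' ^ d * w ^ e else 0) := by
    split_ifs <;> positivity
  have n3 : 0 ≤ 32 ^ |a| * 32 ^ |b| * 32 ^ |c| * 32 ^ |d| *
      ((1 + x) ^ (a + c) * (1 + y) ^ (b + d) * w ^ e) := by positivity
  have n4 : 0 ≤ 32 ^ |e| *
      (x ^ a * x' ^ c * (1 + x) ^ e * (y ^ b * y' ^ d * (1 + y) ^ e)) := by positivity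
  by_cases c1 : x ≤ 1 / 2 ∧ y ≤ 1 / 2
  · have e1 : x' ^ c ≤ 32 ^ |c| * 1 ^ c :=
      rpow_le_of_comparable px1 one_pos (by linarith) (by linarith) c
    have e2 : y' ^ d ≤ 32 ^ |d| * 1 ^ d :=
      rpow_le_of_comparable py1 one_pos (by linarith) (by linarith) d
    rw [Real.one_rpow, mul_one] at e1 e2
    rw [if_pos c1] at n1 ⊢
    have : x ^ a * y ^ b * x' ^ c * y' ^ d * w ^ e ≤
        x ^ a * y ^ b * 32 ^ |c| * 32 ^ |d| * w ^ e := by gcongr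
    linarith
  by_cases c2 : x' ≤ 1 / 2 ∧ y' ≤ 1 / 2
  · have e1 : x ^ a ≤ 32 ^ |a| * 1 ^ a :=
      rpow_le_of_comparable px one_pos (by linarith) (by linarith) a
    have e2 : y ^ b ≤ 32 ^ |b| * 1 ^ b :=
      rpow_le_of_comparable py one_pos (by linarith) (by linarith) b
    rw [Real.one_rpow, mul_one] at e1 e2
    rw [if_pos c2] at n2 ⊢
    have : x ^ a * y ^ b * x' ^ c * y' ^ d * w ^ e ≤
        32 ^ |a| * 32 ^ |b| * x' ^ c * y' ^ d * w ^ e := by gcongr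
    linarith
  by_cases c3 : (1 / 4 ≤ x ∧ 1 / 4 ≤ x') ∧ (1 / 4 ≤ y ∧ 1 / 4 ≤ y')
  · obtain ⟨⟨_, _⟩, _, _⟩ := c3
    have e1 : x ^ a ≤ 32 ^ |a| * (1 + x) ^ a :=
      rpow_le_of_comparable px (by positivity) (by linarith) (by linarith) a
    have e2 : y ^ b ≤ 32 ^ |b| * (1 + y) ^ b :=
      rpow_le_of_comparable py (by positivity) (by linarith) (by linarith) b
    have e3 : x' ^ c ≤ 32 ^ |c| * (1 + x) ^ c :=
      rpow_le_of_comparable px1 (by positivity) (by linarith) (by linarith) c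
    have e4 : y' ^ d ≤ 32 ^ |d| * (1 + y) ^ d :=
      rpow_le_of_comparable py1 (by positivity) (by linarith) (by linarith) d
    have : x ^ a * y ^ b * x' ^ c * y' ^ d * w ^ e ≤
        (32 ^ |a| * (1 + x) ^ a) * (32 ^ |b| * (1 + y) ^ b) * (32 ^ |c| * (1 + x) ^ c) *
          (32 ^ |d| * (1 + y) ^ d) * w ^ e := by gcongr
    rw [Real.rpow_add (by positivity), Real.rpow_add (by positivity)] at n3 ⊢
    linarith
  · have hw : 1 / 4 ≤ w := by grind
    have hxy : x ≤ 5 / 4 ∨ y ≤ 5 / 4 := by grind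
    have e1 : w ^ e ≤ 32 ^ |e| * ((1 + x) * (1 + y)) ^ e := by
      have hp := mul_pos px py
      refine rpow_le_of_comparable pw (by positivity) (by linarith) ?_ e
      rcases hxy with hxy | hxy
      · have := mul_le_mul_of_nonneg_right hxy py.le
        linarith
      · have := mul_le_mul_of_nonneg_left hxy px.le
        linarith
    rw [Real.mul_rpow (by positivity) (by positivity)] at e1
    have : x ^ a * y ^ b * x' ^ c * y' ^ d * w ^ e ≤
        x ^ a * y ^ b * x' ^ c * y' ^ d * (32 ^ |e| * ((1 + x) ^ e * (1 + y) ^ e)) := by gcongr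
    linarith

/-- The integrand majorised uniformly in a neighbourhood of the exponents. -/
lemma integrable_kobaNielsen_box {a b c d e δ : ℝ}
    (h : ∀ a' b' c' d' e' : ℝ, |a' - a| ≤ δ → |b' - b| ≤ δ → |c' - c| ≤ δ → |d' - d| ≤ δ →
      |e' - e| ≤ δ → Integrable (fun z : ℝ × ℝ =>
        |z.1| ^ a' * |z.2| ^ b' * |1 - z.1| ^ c' * |1 - z.2| ^ d' * |z.1 - z.2| ^ e'))
    (hδ : 0 < δ) :
    Integrable (fun z : ℝ × ℝ =>
      (|z.1| ^ (a - δ) + |z.1| ^ (a + δ)) * (|z.2| ^ (b - δ) + |z.2| ^ (b + δ)) *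
      (|1 - z.1| ^ (c - δ) + |1 - z.1| ^ (c + δ)) * (|1 - z.2| ^ (d - δ) + |1 - z.2| ^ (d + δ)) *
      (|z.1 - z.2| ^ (e - δ) + |z.1 - z.2| ^ (e + δ))) := by
  have hm (t : ℝ) : |t - δ - t| ≤ δ := by rw [sub_sub_cancel_left, abs_neg, abs_of_pos hδ]
  have hp (t : ℝ) : |t + δ - t| ≤ δ := by rw [add_sub_cancel_left, abs_of_pos hδ]
  have h1 (b' c' d' e' : ℝ) (hb : |b' - b| ≤ δ) (hc : |c' - c| ≤ δ) (hd : |d' - d| ≤ δ)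
      (he : |e' - e| ≤ δ) := (h _ b' c' d' e' (hm a) hb hc hd he).add
        (h _ b' c' d' e' (hp a) hb hc hd he)
  have h2 (c' d' e' : ℝ) (hc : |c' - c| ≤ δ) (hd : |d' - d| ≤ δ)
      (he : |e' - e| ≤ δ) := (h1 _ c' d' e' (hm b) hc hd he).add (h1 _ c' d' e' (hp b) hc hd he)
  have h3 (d' e' : ℝ) (hd : |d' - d| ≤ δ) (he : |e' - e| ≤ δ) :=
    (h2 _ d' e' (hm c) hd he).add (h2 _ d' e' (hp c) hd he)
  have h4 (e' : ℝ) (he : |e' - e| ≤ δ) := (h3 _ e' (hm d) he).add (h3 _ e' (hp d) he)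
  refine ((h4 _ (hm e)).add (h4 _ (hp e))).congr (Filter.Eventually.of_forall fun z => ?_)
  simp only [Pi.add_apply]
  ring

/-- The logarithm of the integrand, as a linear form in the exponents. -/
noncomputable def logForm (z : ℝ × ℝ) : (ℂ × ℂ × ℂ × ℂ × ℂ) →L[ℂ] ℂ :=
  ((Real.log |z.1| : ℝ) : ℂ) • ContinuousLinearMap.fst ℂ _ _ +
  ((Real.log |z.2| : ℝ) : ℂ) • (ContinuousLinearMap.fst ℂ _ _ ∘L ContinuousLinearMap.snd ℂ _ _) +
  ((Real.log |1 - z.1| : ℝ) : ℂ) • (ContinuousLinearMap.fst ℂ _ _ ∘L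
    ContinuousLinearMap.snd ℂ _ _ ∘L ContinuousLinearMap.snd ℂ _ _) +
  ((Real.log |1 - z.2| : ℝ) : ℂ) • (ContinuousLinearMap.fst ℂ _ _ ∘L
    ContinuousLinearMap.snd ℂ _ _ ∘L ContinuousLinearMap.snd ℂ _ _ ∘L
    ContinuousLinearMap.snd ℂ _ _) +
  ((Real.log |z.1 - z.2| : ℝ) : ℂ) • (ContinuousLinearMap.snd ℂ _ _ ∘L
    ContinuousLinearMap.snd ℂ _ _ ∘L ContinuousLinearMap.snd ℂ _ _ ∘L
    ContinuousLinearMap.snd ℂ _ _)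

lemma logForm_apply (z : ℝ × ℝ) (s : ℂ × ℂ × ℂ × ℂ × ℂ) :
    logForm z s = (Real.log |z.1| : ℝ) * s.1 + (Real.log |z.2| : ℝ) * s.2.1 +
      (Real.log |1 - z.1| : ℝ) * s.2.2.1 + (Real.log |1 - z.2| : ℝ) * s.2.2.2.1 +
      (Real.log |z.1 - z.2| : ℝ) * s.2.2.2.2 := rfl

/-- The sum of the absolute values of the coefficients of `logForm`. -/
noncomputable def logSum (z : ℝ × ℝ) : ℝ :=
  |Real.log (|z.1|)| + |Real.log (|z.2|)| + |Real.log (|1 - z.1|)| + |Real.log (|1 - z.2|)| +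
    |Real.log (|z.1 - z.2|)|

lemma norm_logForm_apply_le (z : ℝ × ℝ) (s : ℂ × ℂ × ℂ × ℂ × ℂ) :
    ‖logForm z s‖ ≤ logSum z * ‖s‖ := by
  have a1 : ‖s.1‖ ≤ ‖s‖ := norm_fst_le s
  have b1 : ‖s.2‖ ≤ ‖s‖ := norm_snd_le s
  have a2 : ‖s.2.1‖ ≤ ‖s‖ := (norm_fst_le s.2).trans b1
  have b2 : ‖s.2.2‖ ≤ ‖s‖ := (norm_snd_le s.2).trans b1
  have a3 : ‖s.2.2.1‖ ≤ ‖s‖ := (norm_fst_le s.2.2).trans b2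
  have b3 : ‖s.2.2.2‖ ≤ ‖s‖ := (norm_snd_le s.2.2).trans b2
  have a4 : ‖s.2.2.2.1‖ ≤ ‖s‖ := (norm_fst_le s.2.2.2).trans b3
  have a5 : ‖s.2.2.2.2‖ ≤ ‖s‖ := (norm_snd_le s.2.2.2).trans b3
  have key (t : ℝ) (w : ℂ) (hw : ‖w‖ ≤ ‖s‖) : ‖(t : ℂ) * w‖ ≤ |t| * ‖s‖ := by
    rw [norm_mul, Complex.norm_real, Real.norm_eq_abs]
    gcongr
  rw [logForm_apply, logSum]
  simp only [add_mul]
  exact norm_add_le_of_le (norm_add_le_of_le (norm_add_le_of_le (norm_add_le_of_le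
    (key _ _ a1) (key _ _ a2)) (key _ _ a3)) (key _ _ a4)) (key _ _ a5)

lemma logSum_nonneg (z : ℝ × ℝ) : 0 ≤ logSum z := by unfold logSum; positivity

lemma norm_logForm_le (z : ℝ × ℝ) : ‖logForm z‖ ≤ logSum z :=
  ContinuousLinearMap.opNorm_le_bound _ (logSum_nonneg z) (norm_logForm_apply_le z)

lemma aestronglyMeasurable_logForm : AEStronglyMeasurable logForm := by
  have m {f : ℝ × ℝ → ℝ} (hf : Measurable f) (L : (ℂ × ℂ × ℂ × ℂ × ℂ) →L[ℂ] ℂ) :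
      AEStronglyMeasurable (fun z => ((f z : ℝ) : ℂ) • L) := by
    have : Measurable (fun z => ((f z : ℝ) : ℂ)) := by fun_prop
    exact this.aestronglyMeasurable.smul_const L
  exact ((((m (by fun_prop) _).add (m (by fun_prop) _)).add (m (by fun_prop) _)).add
    (m (by fun_prop) _)).add (m (by fun_prop) _)

lemma KN5integrand_eq_exp {z : ℝ × ℝ} (h : 0 < |z.1| ∧ 0 < |z.2| ∧ 0 < |1 - z.1| ∧
    0 < |1 - z.2| ∧ 0 < |z.1 - z.2|) (s : ℂ × ℂ × ℂ × ℂ × ℂ) :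
    KN5integrand s z = Complex.exp (logForm z s) := by
  obtain ⟨h1, h2, h3, h4, h5⟩ := h
  have key {t : ℝ} (ht : 0 < t) (w : ℂ) : (t : ℂ) ^ w = Complex.exp ((Real.log t : ℝ) * w) := by
    rw [Complex.cpow_def_of_ne_zero (by exact_mod_cast ht.ne'), Complex.ofReal_log ht.le]
  rw [KN5integrand, key h1, key h2, key h3, key h4, key h5, logForm_apply]
  simp only [Complex.exp_add]

lemma measurable_KN5integrand (s : ℂ × ℂ × ℂ × ℂ × ℂ) : Measurable (KN5integrand s) := by
  unfold KN5integrand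
  fun_prop

lemma exp_mul_log_add_le {u δ : ℝ} (hu : 0 < u) (a : ℝ) :
    Real.exp (a * Real.log u + δ * |Real.log u|) ≤ u ^ (a - δ) + u ^ (a + δ) := by
  rw [Real.rpow_def_of_pos hu, Real.rpow_def_of_pos hu]
  rcases abs_cases (Real.log u) with ⟨h, _⟩ | ⟨h, _⟩ <;> rw [h]
  · refine le_add_of_nonneg_of_le (Real.exp_pos _).le (le_of_eq ?_)
    ring_nf
  · refine le_add_of_le_of_nonneg (le_of_eq ?_) (Real.exp_pos _).le
    ring_nf

lemma re_logForm (z : ℝ × ℝ) (s : ℂ × ℂ × ℂ × ℂ × ℂ) :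
    (logForm z s).re = s.1.re * Real.log |z.1| + s.2.1.re * Real.log |z.2| +
      s.2.2.1.re * Real.log |1 - z.1| + s.2.2.2.1.re * Real.log |1 - z.2| +
      s.2.2.2.2.re * Real.log |z.1 - z.2| := by
  rw [logForm_apply]
  simp only [Complex.add_re, Complex.re_ofReal_mul]
  ring

lemma exp_re_logForm_add_le {z : ℝ × ℝ} (h : 0 < |z.1| ∧ 0 < |z.2| ∧ 0 < |1 - z.1| ∧
    0 < |1 - z.2| ∧ 0 < |z.1 - z.2|) (s : ℂ × ℂ × ℂ × ℂ × ℂ) (δ : ℝ) :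
    Real.exp ((logForm z s).re + δ * logSum z) ≤
      (|z.1| ^ (s.1.re - δ) + |z.1| ^ (s.1.re + δ)) *
      (|z.2| ^ (s.2.1.re - δ) + |z.2| ^ (s.2.1.re + δ)) *
      (|1 - z.1| ^ (s.2.2.1.re - δ) + |1 - z.1| ^ (s.2.2.1.re + δ)) *
      (|1 - z.2| ^ (s.2.2.2.1.re - δ) + |1 - z.2| ^ (s.2.2.2.1.re + δ)) *
      (|z.1 - z.2| ^ (s.2.2.2.2.re - δ) + |z.1 - z.2| ^ (s.2.2.2.2.re + δ)) := by
  obtain ⟨h1, h2, h3, h4, h5⟩ := h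
  have e : (logForm z s).re + δ * logSum z =
      (s.1.re * Real.log |z.1| + δ * |Real.log (|z.1|)|) +
      (s.2.1.re * Real.log |z.2| + δ * |Real.log (|z.2|)|) +
      (s.2.2.1.re * Real.log |1 - z.1| + δ * |Real.log (|1 - z.1|)|) +
      (s.2.2.2.1.re * Real.log |1 - z.2| + δ * |Real.log (|1 - z.2|)|) +
      (s.2.2.2.2.re * Real.log |z.1 - z.2| + δ * |Real.log (|z.1 - z.2|)|) := by
    rw [re_logForm, logSum]
    ring
  rw [e, Real.exp_add, Real.exp_add, Real.exp_add, Real.exp_add]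
  gcongr <;> apply exp_mul_log_add_le <;> assumption

lemma exists_box {s : ℂ × ℂ × ℂ × ℂ × ℂ} (hs : s ∈ KN5region) : ∃ δ > 0,
    ∀ a' b' c' d' e' : ℝ, |a' - s.1.re| ≤ δ → |b' - s.2.1.re| ≤ δ → |c' - s.2.2.1.re| ≤ δ →
      |d' - s.2.2.2.1.re| ≤ δ → |e' - s.2.2.2.2.re| ≤ δ → Integrable (fun z : ℝ × ℝ =>
        |z.1| ^ a' * |z.2| ^ b' * |1 - z.1| ^ c' * |1 - z.2| ^ d' * |z.1 - z.2| ^ e') := by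
  obtain ⟨h1, h2, h3, h4, h5, h6, h7, h8, h9, h10⟩ := hs
  generalize s.1.re = a at *
  generalize s.2.1.re = b at *
  generalize s.2.2.1.re = c at *
  generalize s.2.2.2.1.re = d at *
  generalize s.2.2.2.2.re = e at *
  have hpos : 0 < min (a + 1) (min (b + 1) (min (c + 1) (min (d + 1) (min (e + 1)
      (min ((a + b + e + 2) / 5) (min ((c + d + e + 2) / 5) (min ((-1 - (a + c + e)) / 5)
        (min ((-1 - (b + d + e)) / 5) ((-2 - (a + b + c + d + e)) / 5))))))))) := by
    simp only [lt_min_iff]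
    refine ⟨?_, ?_, ?_, ?_, ?_, ?_, ?_, ?_, ?_, ?_⟩ <;> linarith
  obtain ⟨δ, hδ, hlt⟩ := exists_between hpos
  simp only [lt_min_iff] at hlt
  obtain ⟨l1, l2, l3, l4, l5, l6, l7, l8, l9, l10⟩ := hlt
  refine ⟨δ, hδ, fun a' b' c' d' e' ha hb hc hd he => ?_⟩
  rw [abs_le] at ha hb hc hd he
  apply integrable_kobaNielsen_real <;> linarith

lemma integrable_KN5integrand {s : ℂ × ℂ × ℂ × ℂ × ℂ} (hs : s ∈ KN5region) :
    Integrable (KN5integrand s) := by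
  obtain ⟨δ, hδ, h⟩ := exists_box hs
  have h0 := h s.1.re s.2.1.re s.2.2.1.re s.2.2.2.1.re s.2.2.2.2.re
    (by simp [hδ.le]) (by simp [hδ.le]) (by simp [hδ.le]) (by simp [hδ.le]) (by simp [hδ.le])
  refine h0.mono' (measurable_KN5integrand s).aestronglyMeasurable ?_
  filter_upwards [ae_generic] with z ⟨h1, h2, h3, h4, h5⟩
  rw [KN5integrand]
  simp only [norm_mul]
  rw [Complex.norm_cpow_eq_rpow_re_of_pos h1, Complex.norm_cpow_eq_rpow_re_of_pos h2,
    Complex.norm_cpow_eq_rpow_re_of_pos h3, Complex.norm_cpow_eq_rpow_re_of_pos h4,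
    Complex.norm_cpow_eq_rpow_re_of_pos h5]

lemma differentiableAt_integral_KN5integrand {s₀ : ℂ × ℂ × ℂ × ℂ × ℂ} (hs : s₀ ∈ KN5region) :
    DifferentiableAt ℂ (fun s => ∫ x : ℝ × ℝ, KN5integrand s x) s₀ := by
  obtain ⟨δ, hδ, h⟩ := exists_box hs
  have hε : 0 < δ / 2 := by positivity
  have hbound := (integrable_kobaNielsen_box h hδ).const_mul (δ / 2)⁻¹
  refine (hasFDerivAt_integral_of_dominated_of_fderiv_le
    (F' := fun s z => Complex.exp (logForm z s) • logForm z) (Metric.ball_mem_nhds s₀ hε)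
    (Filter.Eventually.of_forall fun s => (measurable_KN5integrand s).aestronglyMeasurable)
    (integrable_KN5integrand hs) ?_ ?_ hbound ?_).differentiableAt
  · have hm : AEStronglyMeasurable (fun z => Complex.exp (logForm z s₀)) := by
      refine (measurable_KN5integrand s₀).aestronglyMeasurable.congr ?_
      filter_upwards [ae_generic] with z hz using KN5integrand_eq_exp hz s₀
    exact hm.smul aestronglyMeasurable_logForm
  · filter_upwards [ae_generic] with z hz s hs'
    have hΛ := logSum_nonneg z
    have hd : (logForm z s).re ≤ (logForm z s₀).re + δ / 2 * logSum z := by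
      have e1 : (logForm z (s - s₀)).re ≤ logSum z * ‖s - s₀‖ :=
        (Complex.re_le_norm _).trans (norm_logForm_apply_le z _)
      rw [map_sub, Complex.sub_re] at e1
      have e2 : logSum z * ‖s - s₀‖ ≤ logSum z * (δ / 2) := by
        gcongr
        exact (mem_ball_iff_norm.1 hs').le
      linarith
    have hl : logSum z ≤ (δ / 2)⁻¹ * Real.exp (δ / 2 * logSum z) := by
      rw [inv_mul_eq_div, le_div_iff₀ hε]
      linarith [Real.add_one_le_exp (δ / 2 * logSum z)]
    rw [norm_smul, Complex.norm_exp]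
    calc Real.exp (logForm z s).re * ‖logForm z‖
        ≤ Real.exp ((logForm z s₀).re + δ / 2 * logSum z) *
          ((δ / 2)⁻¹ * Real.exp (δ / 2 * logSum z)) := by
          gcongr
          exact (norm_logForm_le z).trans hl
      _ = (δ / 2)⁻¹ * Real.exp ((logForm z s₀).re + δ * logSum z) := by
          rw [mul_left_comm, ← Real.exp_add]
          ring_nf
      _ ≤ _ := by
          gcongr
          exact exp_re_logForm_add_le hz s₀ δ
  · filter_upwards [ae_generic] with z hz s _
    have : (fun s => KN5integrand s z) = fun s => Complex.exp (logForm z s) :=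
      funext (KN5integrand_eq_exp hz)
    rw [this]
    exact (logForm z).hasFDerivAt.cexp

/-- The real Koba-Nielsen local zeta function `Z^(5)(s)` converges and is holomorphic on
the region `KN5region`. -/
theorem kobaNielsen_five_points_convergent_and_holomorphic :
    (∀ s ∈ KN5region, Integrable (KN5integrand s)) ∧
    DifferentiableOn ℂ (fun s => ∫ x : ℝ × ℝ, KN5integrand s x) KN5region := by
  exact ⟨fun _ hs => integrable_KN5integrand hs,
    fun _ hs => (differentiableAt_integral_KN5integrand hs).differentiableWithinAt⟩
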